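/- arXiv:2406.09748 — 2 statements merged into one kernel-verified Lean document; each statement's English description precedes it below -/
import Mathlib

section
/- Let X be a compact metrizable topological space, let Δ be a weak-*-closed set of Borel probability measures on X, and let ω be a free (non-principal) ultrafilter on ℕ. Then the following are equivalent: (i) (X, Δ) has the small boundary property; (ii) for every uniformly bounded sequence (f_n) of continuous real-valued functions on X and every ε > 0 there exist uniformly bounded sequences (g_n) and (h_n) of continuous real-valued functions on X such that sup_n ‖f_n − g_n‖_∞ < ε and lim_{n→ω} sup_{μ∈Δ} ∫_X |g_n h_n − 1|² dμ = 0. (Condition (ii) expresses that the quotient C*-algebra ℓ^∞(C(X))/J_{2,ω,Δ} has real rank zero, where J_{2,ω,Δ} is the ideal of bounded sequences (a_n) with lim_{n→ω} sup_{μ∈Δ} ∫ |a_n|² dμ = 0.) -/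
open MeasureTheory Filter Topology
open scoped NNReal ENNReal

/-- The pair `(X, Δ)` has the small boundary property. -/
def SmallBoundaryProperty {X : Type*} [TopologicalSpace X] [MeasurableSpace X]
    (Δ : Set (ProbabilityMeasure X)) : Prop :=
  ∀ (x : X) (U : Set X), IsOpen U → x ∈ U →
    ∃ V : Set X, IsClosed V ∧ x ∈ interior V ∧ V ⊆ U ∧
      ∀ μ ∈ Δ, μ (frontier V) = 0

/-- Under the small boundary property, compact sets have arbitrarily small closed neighbourhoods
with null boundary. -/
theorem SmallBoundaryProperty.exists_of_isCompact {X : Type*} [TopologicalSpace X]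
    [MeasurableSpace X] {Δ : Set (ProbabilityMeasure X)} (h : SmallBoundaryProperty Δ)
    {K U : Set X} (hK : IsCompact K) (hU : IsOpen U) (hKU : K ⊆ U) :
    ∃ V : Set X, IsClosed V ∧ K ⊆ interior V ∧ V ⊆ U ∧
      ∀ μ ∈ Δ, (μ : Measure X) (frontier V) = 0 := by
  refine hK.induction_on
    (p := fun S => ∃ V : Set X, IsClosed V ∧ S ⊆ interior V ∧ V ⊆ U ∧
      ∀ μ ∈ Δ, (μ : Measure X) (frontier V) = 0)
    ⟨∅, isClosed_empty, by simp, by simp, by simp⟩ ?_ ?_ ?_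
  · rintro S T hST ⟨V, hV, hTV, hVU, h0⟩
    exact ⟨V, hV, hST.trans hTV, hVU, h0⟩
  · rintro S T ⟨V, hV, hSV, hVU, hV0⟩ ⟨W, hW, hTW, hWU, hW0⟩
    refine ⟨V ∪ W, hV.union hW, (Set.union_subset_union hSV hTW).trans ?_,
      Set.union_subset hVU hWU, fun μ hμ => ?_⟩
    · exact interior_maximal (Set.union_subset_union interior_subset interior_subset)
        (isOpen_interior.union isOpen_interior)
    · exact measure_mono_null ((frontier_union_subset V W).trans
        (Set.union_subset_union Set.inter_subset_left Set.inter_subset_right))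
        (measure_union_null (hV0 μ hμ) (hW0 μ hμ))
  · intro x hx
    obtain ⟨V, hV, hxV, hVU, h0⟩ := h x U hU (hKU hx)
    exact ⟨interior V, mem_nhdsWithin_of_mem_nhds (isOpen_interior.mem_nhds hxV), V, hV, subset_rfl,
      hVU, fun μ hμ => (μ.null_iff_toMeasure_null _).1 (h0 μ hμ)⟩

/-- A closed set which is null for all measures in a closed set `Δ` of probability measures on a
compact space has open neighbourhoods which are uniformly small on `Δ`. -/
theorem exists_isOpen_forall_measure_le {X : Type*} [TopologicalSpace X] [CompactSpace X]
    [TopologicalSpace.MetrizableSpace X] [MeasurableSpace X] [BorelSpace X]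
    {Δ : Set (ProbabilityMeasure X)} (hΔ : IsClosed Δ) {F : Set X} (hF : IsClosed F)
    (hF0 : ∀ μ ∈ Δ, (μ : Measure X) F = 0) {δ : ℝ≥0∞} (hδ : 0 < δ) :
    ∃ W : Set X, IsOpen W ∧ F ⊆ W ∧ ∀ μ ∈ Δ, (μ : Measure X) W ≤ δ := by
  refine hΔ.isCompact.induction_on
    (p := fun S => ∃ W : Set X, IsOpen W ∧ F ⊆ W ∧ ∀ μ ∈ S, (μ : Measure X) W ≤ δ)
    ⟨Set.univ, isOpen_univ, Set.subset_univ _, by simp⟩ ?_ ?_ ?_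
  · rintro S T hST ⟨W, hW, hFW, h⟩
    exact ⟨W, hW, hFW, fun μ hμ => h μ (hST hμ)⟩
  · rintro S T ⟨W₁, hW₁, hFW₁, h₁⟩ ⟨W₂, hW₂, hFW₂, h₂⟩
    refine ⟨W₁ ∩ W₂, hW₁.inter hW₂, Set.subset_inter hFW₁ hFW₂, ?_⟩
    rintro μ (hμ | hμ)
    · exact (measure_mono Set.inter_subset_left).trans (h₁ μ hμ)
    · exact (measure_mono Set.inter_subset_right).trans (h₂ μ hμ)
  · intro μ hμ
    let := TopologicalSpace.metrizableSpaceMetric X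
    obtain ⟨W₀, hFW₀, hW₀, hlt⟩ := F.exists_isOpen_lt_of_lt (μ := (μ : Measure X)) δ
      (by rwa [hF0 μ hμ])
    obtain ⟨W, hW, hFW, hWW₀⟩ := normal_exists_closure_subset hF hW₀ hFW₀
    have hlim : (𝓝 μ).limsup (fun ν : ProbabilityMeasure X => (ν : Measure X) (closure W)) < δ :=
      (ProbabilityMeasure.limsup_measure_closed_le_of_tendsto tendsto_id isClosed_closure).trans_lt
        ((measure_mono hWW₀).trans_lt hlt)
    exact ⟨_, mem_nhdsWithin_of_mem_nhds (eventually_lt_of_limsup_lt hlim), W, hW, hFW,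
      fun ν hν => (measure_mono subset_closure).trans (le_of_lt hν)⟩

/-- Under the small boundary property, a continuous function `f` can be perturbed by at most `2 * c`
to a function `g` with an approximate inverse `h` of norm at most `c⁻¹`. -/
theorem SmallBoundaryProperty.exists_approx_inverse {X : Type*} [TopologicalSpace X]
    [CompactSpace X] [TopologicalSpace.MetrizableSpace X] [MeasurableSpace X] [BorelSpace X]
    {Δ : Set (ProbabilityMeasure X)} (hΔ : IsClosed Δ) (h : SmallBoundaryProperty Δ)
    (f : C(X, ℝ)) {c δ : ℝ} (hc : 0 < c) (hδ : 0 < δ) :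
    ∃ g h : C(X, ℝ), ‖f - g‖ ≤ 2 * c ∧ ‖h‖ ≤ c⁻¹ ∧
      ∀ μ ∈ Δ, ∫ x, (g x * h x - 1) ^ 2 ∂(μ : Measure X) ≤ δ := by
  obtain ⟨V, hV, hfV, hVf, hV0⟩ := h.exists_of_isCompact
    (isClosed_le continuous_const f.continuous : IsClosed {x | 0 ≤ f x}).isCompact
    (isOpen_lt continuous_const f.continuous : IsOpen {x | -c < f x})
    (fun x hx => (neg_neg_of_pos hc).trans_le hx)
  obtain ⟨W, hW, hVW, hWδ⟩ := exists_isOpen_forall_measure_le hΔ isClosed_frontier hV0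
    (ENNReal.ofReal_pos.2 hδ)
  obtain ⟨φ, hφ0, hφ1, hφ⟩ := exists_continuous_zero_one_of_isClosed
    (isOpen_interior.union hW).isClosed_compl (hV.sdiff hW) (by
      rw [Set.disjoint_left]
      rintro x hx ⟨hxV, hxW⟩
      refine hx (Or.inl ?_)
      by_contra hxi
      exact hxW (hVW ⟨subset_closure hxV, hxi⟩))
  let g : C(X, ℝ) := f + ContinuousMap.const X (2 * c) * (2 * φ - 1)
  have hg (x) : g x = f x + 2 * c * (2 * φ x - 1) := rfl
  have hpos (x) : 0 < max (g x ^ 2) (c ^ 2) := lt_max_of_lt_right (by positivity)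
  let k : C(X, ℝ) := ⟨fun x => g x / max (g x ^ 2) (c ^ 2),
    g.continuous.div ((g.continuous.pow 2).max continuous_const) fun x => (hpos x).ne'⟩
  have hk (x) : k x = g x / max (g x ^ 2) (c ^ 2) := rfl
  have hgW (x) (hx : x ∉ W) : c ^ 2 ≤ g x ^ 2 := by
    rw [sq_le_sq, abs_of_pos hc, le_abs]
    by_cases hxV : x ∈ V
    · left
      have h1 : φ x = 1 := hφ1 ⟨hxV, hx⟩
      have h2 : -c < f x := hVf hxV
      rw [hg, h1]; linarith
    · right
      have hxi : x ∉ interior V := fun h => hxV (interior_subset h)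
      have h1 : φ x = 0 := hφ0 (by rintro (h | h) <;> contradiction)
      have h2 : f x < 0 := lt_of_not_ge fun h => hxi (hfV h)
      rw [hg, h1]; linarith
  have hgk (x) : (g x * k x - 1) ^ 2 ≤ W.indicator (fun _ => (1 : ℝ)) x := by
    have hgkx : g x * k x = g x ^ 2 / max (g x ^ 2) (c ^ 2) := by rw [hk]; ring
    by_cases hx : x ∈ W
    · rw [Set.indicator_of_mem hx, hgkx, sq_le_one_iff_abs_le_one, abs_le]
      have h0 : 0 ≤ g x ^ 2 / max (g x ^ 2) (c ^ 2) := div_nonneg (sq_nonneg _) (hpos x).le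
      have h1 : g x ^ 2 / max (g x ^ 2) (c ^ 2) ≤ 1 := div_le_one_of_le₀ (le_max_left _ _) (hpos x).le
      constructor <;> linarith
    · have := hpos x
      rw [max_eq_left (hgW x hx)] at hgkx this
      rw [Set.indicator_of_notMem hx, hgkx, div_self this.ne']
      simp
  refine ⟨g, k, ?_, ?_, fun μ hμ => ?_⟩
  · rw [ContinuousMap.norm_le _ (by positivity)]
    intro x
    have := hφ x
    rw [ContinuousMap.sub_apply, hg, Real.norm_eq_abs, abs_le]
    constructor <;> nlinarith [this.1, this.2]
  · rw [ContinuousMap.norm_le _ (by positivity)]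
    intro x
    rw [hk, norm_div, Real.norm_eq_abs, Real.norm_eq_abs, abs_of_pos (hpos x), div_le_iff₀ (hpos x),
      inv_mul_eq_div, le_div_iff₀ hc]
    rcases le_total |g x| c with h | h
    · exact le_trans (by nlinarith [abs_nonneg (g x)]) (le_max_right _ _)
    · exact le_trans (by nlinarith [abs_nonneg (g x), sq_abs (g x)]) (le_max_left _ _)
  · calc ∫ x, (g x * k x - 1) ^ 2 ∂(μ : Measure X)
        ≤ ∫ x, W.indicator (fun _ => (1 : ℝ)) x ∂(μ : Measure X) :=
          integral_mono_of_nonneg (.of_forall fun x => sq_nonneg _)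
            ((integrable_const 1).indicator hW.measurableSet) (.of_forall hgk)
      _ = (μ : Measure X).real W := by
          rw [integral_indicator_const _ hW.measurableSet, smul_eq_mul, mul_one]
      _ ≤ δ := ENNReal.toReal_le_of_le_ofReal hδ.le (hWδ μ hμ)

/-- The supremum over `Δ` of the integrals of `f ^ 2` is an honest upper bound of them. -/
theorem integral_sq_le_iSup {X : Type*} [TopologicalSpace X] [CompactSpace X] [MeasurableSpace X]
    [BorelSpace X] {Δ : Set (ProbabilityMeasure X)} (f : C(X, ℝ)) {μ : ProbabilityMeasure X}
    (hμ : μ ∈ Δ) :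
    ∫ x, f x ^ 2 ∂(μ : Measure X) ≤ ⨆ ν ∈ Δ, ∫ x, f x ^ 2 ∂(ν : Measure X) := by
  have hb (ν : ProbabilityMeasure X) : ∫ x, f x ^ 2 ∂(ν : Measure X) ≤ ‖f‖ ^ 2 := by
    refine (integral_mono_of_nonneg (g := fun _ => ‖f‖ ^ 2) (.of_forall fun x => sq_nonneg _)
      (integrable_const _) (.of_forall fun x => ?_)).trans (by simp)
    exact sq_le_sq.2 (by simpa using f.norm_coe_le_norm x)
  refine le_trans ?_ (le_ciSup (f := fun ν => ⨆ _ : ν ∈ Δ, ∫ x, f x ^ 2 ∂(ν : Measure X))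
    ⟨‖f‖ ^ 2, ?_⟩ μ)
  · exact (ciSup_pos (f := fun _ => ∫ x, f x ^ 2 ∂(μ : Measure X)) hμ).ge
  · rintro _ ⟨ν, rfl⟩
    exact Real.iSup_le (fun _ => hb ν) (sq_nonneg _)

/-- If `g` has an approximate inverse of norm at most `M`, then it is rarely small. -/
theorem measureReal_abs_le_le_integral {X : Type*} [TopologicalSpace X] [CompactSpace X]
    [MeasurableSpace X] [BorelSpace X] (μ : Measure X) [IsProbabilityMeasure μ] (g h : C(X, ℝ))
    {M : ℝ} (hM : 0 < M) (hh : ‖h‖ ≤ M) :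
    μ.real {x | |g x| ≤ (2 * M)⁻¹} ≤ 4 * ∫ x, (g x * h x - 1) ^ 2 ∂μ := by
  have hint : Integrable (fun x => (g x * h x - 1) ^ 2) μ :=
    (show Continuous fun x => (g x * h x - 1) ^ 2 by fun_prop).integrable_of_hasCompactSupport
      (HasCompactSupport.of_compactSpace _)
  have hsub : {x | |g x| ≤ (2 * M)⁻¹} ⊆ {x | 1 / 4 ≤ (g x * h x - 1) ^ 2} := by
    intro x hx
    have h1 : |g x * h x| ≤ 1 / 2 := by
      rw [abs_mul]
      calc |g x| * |h x| ≤ (2 * M)⁻¹ * M :=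
            mul_le_mul hx ((h.norm_coe_le_norm x).trans hh) (abs_nonneg _) (by positivity)
        _ = 1 / 2 := by field_simp
    have := (abs_le.1 h1).2
    show 1 / 4 ≤ (g x * h x - 1) ^ 2
    nlinarith
  have := mul_meas_ge_le_integral_of_nonneg (.of_forall fun x => sq_nonneg (g x * h x - 1)) hint
    (1 / 4)
  have := measureReal_mono (μ := μ) hsub
  linarith

/-- If zero sets of continuous functions can be made uniformly small by small perturbations,
then zero sets can be made null by small perturbations. -/
theorem dense_setOf_forall_measure_zeroSet_eq_zero {X : Type*} [TopologicalSpace X]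
    [CompactSpace X] [MeasurableSpace X] {Δ : Set (ProbabilityMeasure X)}
    (h : ∀ f : C(X, ℝ), ∀ ε > (0 : ℝ), ∀ δ > (0 : ℝ), ∃ g : C(X, ℝ), ‖f - g‖ < ε ∧
      ∃ c > (0 : ℝ), ∀ μ ∈ Δ, (μ : Measure X).real {x | |g x| ≤ c} ≤ δ) :
    Dense {g : C(X, ℝ) | ∀ μ ∈ Δ, (μ : Measure X) {x | g x = 0} = 0} := by
  let G (n : ℕ) : Set C(X, ℝ) :=
    {g | ∃ c > (0 : ℝ), ∀ μ ∈ Δ, (μ : Measure X).real {x | |g x| ≤ c} ≤ 1 / (n + 1 : ℝ)}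
  have hGo (n) : IsOpen (G n) := by
    rw [Metric.isOpen_iff]
    rintro g ⟨c, hc, hg⟩
    refine ⟨c / 2, half_pos hc, fun k hk => ⟨c / 2, half_pos hc, fun μ hμ =>
      (measureReal_mono fun x hx => ?_).trans (hg μ hμ)⟩⟩
    have h1 : |k x - g x| < c / 2 := (ContinuousMap.dist_apply_le_dist x).trans_lt hk
    have h2 : |k x| ≤ c / 2 := hx
    show |g x| ≤ c
    rw [abs_lt] at h1
    rw [abs_le] at h2 ⊢
    constructor <;> linarith
  have hGd (n) : Dense (G n) := by
    rw [Metric.dense_iff]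
    intro f ε hε
    obtain ⟨g, hfg, hg⟩ := h f ε hε (1 / (n + 1 : ℝ)) (by positivity)
    exact ⟨g, by rwa [Metric.mem_ball, dist_comm, dist_eq_norm], hg⟩
  refine (dense_iInter_of_isOpen hGo hGd).mono fun g hg μ hμ => ?_
  rw [← measureReal_eq_zero_iff]
  refine le_antisymm (ge_of_tendsto' tendsto_one_div_add_atTop_nhds_zero_nat fun n => ?_)
    measureReal_nonneg
  obtain ⟨c, hc, hgc⟩ := Set.mem_iInter.1 hg n
  refine (measureReal_mono fun x hx => ?_).trans (hgc μ hμ)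
  have : g x = 0 := hx
  simp [this, hc.le]

/-- The small boundary property holds if functions whose zero set is null are dense. -/
theorem SmallBoundaryProperty.of_dense {X : Type*} [TopologicalSpace X] [CompactSpace X]
    [T2Space X] [MeasurableSpace X] {Δ : Set (ProbabilityMeasure X)}
    (h : Dense {g : C(X, ℝ) | ∀ μ ∈ Δ, (μ : Measure X) {x | g x = 0} = 0}) :
    SmallBoundaryProperty Δ := by
  intro x U hU hx
  obtain ⟨φ, hφ0, hφ1, -⟩ := exists_continuous_zero_one_of_isClosed hU.isClosed_compl
    (isClosed_singleton (x := x)) (by simpa using hx)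
  obtain ⟨g, hg, hdist⟩ := h.exists_dist_lt (2 * φ - 1 : C(X, ℝ)) one_pos
  have hgφ (y) : |(2 * φ y - 1) - g y| < 1 := (ContinuousMap.dist_apply_le_dist y).trans_lt hdist
  have hpos : 0 < g x := by
    have h1 : φ x = 1 := hφ1 rfl
    have := (abs_lt.1 (hgφ x)).2
    linarith
  refine ⟨{y | 0 ≤ g y}, isClosed_le continuous_const g.continuous, ?_, fun y hy => ?_,
    fun μ hμ => ?_⟩
  · have hsub : {y | 0 < g y} ⊆ {y | 0 ≤ g y} := fun y (hy : 0 < g y) => hy.le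
    exact interior_maximal hsub (isOpen_lt continuous_const g.continuous) hpos
  · by_contra hyU
    have h1 : φ y = 0 := hφ0 hyU
    have h2 := (abs_lt.1 (hgφ y)).1
    have h3 : 0 ≤ g y := hy
    linarith
  · rw [ProbabilityMeasure.null_iff_toMeasure_null]
    exact measure_mono_null ((frontier_le_subset_eq continuous_const g.continuous).trans
      fun y hy => Eq.symm hy) (hg μ hμ)

theorem sbp_iff_real_rank_zero
    {X : Type*} [TopologicalSpace X] [CompactSpace X] [TopologicalSpace.MetrizableSpace X]
    [MeasurableSpace X] [BorelSpace X]
    (Δ : Set (ProbabilityMeasure X)) (hΔ : IsClosed Δ)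
    (ω : Ultrafilter ℕ) (hω : (ω : Filter ℕ) ≤ Filter.cofinite) :
    SmallBoundaryProperty Δ ↔
      ∀ f : ℕ → C(X, ℝ), (∃ M : ℝ, ∀ n, ‖f n‖ ≤ M) →
        ∀ ε : ℝ, 0 < ε →
          ∃ g h : ℕ → C(X, ℝ),
            (∃ M : ℝ, ∀ n, ‖g n‖ ≤ M) ∧ (∃ M : ℝ, ∀ n, ‖h n‖ ≤ M) ∧
            (⨆ n, ‖f n - g n‖) < ε ∧
            Tendsto
              (fun n => ⨆ μ ∈ Δ, ∫ x, (g n x * h n x - 1) ^ 2 ∂(μ : Measure X))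
              (ω : Filter ℕ) (nhds 0) := by
  constructor
  · rintro h f ⟨M, hM⟩ ε hε
    choose g k hfg hk hint using fun n : ℕ =>
      h.exists_approx_inverse hΔ (f n) (c := ε / 4) (δ := 1 / (n + 1 : ℝ)) (by positivity)
        (by positivity)
    refine ⟨g, k, ⟨M + 2 * (ε / 4), fun n => ?_⟩, ⟨_, hk⟩, ?_, ?_⟩
    · linarith [norm_le_norm_add_norm_sub (f n) (g n), hM n, hfg n]
    · exact (ciSup_le hfg).trans_lt (by linarith)
    · have hlim : Tendsto (fun n : ℕ => 1 / (n + 1 : ℝ)) (ω : Filter ℕ) (𝓝 0) :=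
        tendsto_one_div_add_atTop_nhds_zero_nat.mono_left (hω.trans_eq Nat.cofinite_eq_atTop)
      refine squeeze_zero (fun n => ?_) (fun n => ?_) hlim
      · exact Real.iSup_nonneg fun μ => Real.iSup_nonneg fun _ =>
          integral_nonneg fun x => sq_nonneg _
      · exact Real.iSup_le (fun μ => Real.iSup_le (fun hμ => hint n μ hμ) (by positivity))
          (by positivity)
  · intro H
    refine .of_dense (dense_setOf_forall_measure_zeroSet_eq_zero fun f ε hε δ hδ => ?_)
    obtain ⟨g, h, ⟨A, hA⟩, ⟨B, hB⟩, hsup, hlim⟩ := H (fun _ => f) ⟨‖f‖, fun _ => le_rfl⟩ ε hε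
    obtain ⟨n, hn⟩ := (hlim.eventually_lt_const (show (0 : ℝ) < δ / 4 by positivity)).exists
    have hbdd : BddAbove (Set.range fun n => ‖f - g n‖) := by
      refine ⟨‖f‖ + A, ?_⟩
      rintro _ ⟨m, rfl⟩
      exact (norm_sub_le _ _).trans (by gcongr; exact hA m)
    have hM : 0 < max B 1 := lt_max_of_lt_right one_pos
    refine ⟨g n, (le_ciSup hbdd n).trans_lt hsup, (2 * max B 1)⁻¹, by positivity, fun μ hμ => ?_⟩
    have h1 := measureReal_abs_le_le_integral (μ : Measure X) (g n) (h n) hM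
      ((hB n).trans (le_max_left _ _))
    have h2 : ∫ x, (g n x * h n x - 1) ^ 2 ∂(μ : Measure X) ≤
        ⨆ ν ∈ Δ, ∫ x, (g n x * h n x - 1) ^ 2 ∂(ν : Measure X) :=
      integral_sq_le_iSup (g n * h n - 1) hμ
    linarith
end

section
/- Let X be a compact metrizable topological space, let Δ be a weak-*-closed set of Borel probability measures on X, and let ω be a free (non-principal) ultrafilter on ℕ. Then (X, Δ) has the small boundary property if and only if for every uniformly bounded sequence (f_n) of continuous real-valued functions on X and every ε > 0 there exist uniformly bounded sequences (g_n) and (h_n) of continuous real-valued functions on X such that lim_{n→ω} sup_{μ∈Δ} (∫_X |f_n − g_n|² dμ)^{1/2} < ε and lim_{n→ω} sup_{μ∈Δ} ∫_X |g_n h_n − 1|² dμ = 0. (This expresses that in ℓ^∞(C(X))/J_{2,ω,Δ} the invertible self-adjoint elements are dense in the self-adjoint elements with respect to the uniform trace norm ‖·‖_{2,ω,Δ}.) -/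
open MeasureTheory Filter Topology
open scoped NNReal ENNReal

lemma biSup_le_of_nonneg {α : Type*} {s : Set α} {F : α → ℝ} {b : ℝ} (hb : 0 ≤ b)
    (h : ∀ a ∈ s, F a ≤ b) : ⨆ a ∈ s, F a ≤ b :=
  Real.iSup_le (fun a => Real.iSup_le (fun ha => h a ha) hb) hb

lemma biSup_nonneg_of_nonneg {α : Type*} {s : Set α} {F : α → ℝ} (h : ∀ a, 0 ≤ F a) :
    0 ≤ ⨆ a ∈ s, F a :=
  Real.iSup_nonneg fun a => Real.iSup_nonneg fun _ => h a

lemma le_biSup_of_bounded {α : Type*} {s : Set α} {F : α → ℝ} {b : ℝ} (hb : 0 ≤ b)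
    (h : ∀ a ∈ s, F a ≤ b) {a : α} (ha : a ∈ s) : F a ≤ ⨆ a ∈ s, F a := by
  have hbdd : BddAbove (Set.range fun a => ⨆ _ : a ∈ s, F a) := by
    refine ⟨b, ?_⟩
    rintro _ ⟨a, rfl⟩
    exact Real.iSup_le (fun ha => h a ha) hb
  simpa [ha] using le_ciSup hbdd a

section SmallBoundary

variable {X : Type*} [TopologicalSpace X] [CompactSpace X] [MeasurableSpace X]
  {Δ : Set (ProbabilityMeasure X)}

lemma integrable_of_continuous [BorelSpace X] (μ : ProbabilityMeasure X) {f : X → ℝ}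
    (hf : Continuous f) : Integrable f (μ : Measure X) :=
  BoundedContinuousFunction.integrable (μ : Measure X)
    (BoundedContinuousFunction.mkOfCompact ⟨f, hf⟩)

lemma integral_le_norm [BorelSpace X] (μ : ProbabilityMeasure X) (f : C(X, ℝ)) :
    ∫ x, f x ∂(μ : Measure X) ≤ ‖f‖ := by
  simpa using integral_mono (integrable_of_continuous μ f.continuous)
    (integrable_const ‖f‖) fun x => (le_abs_self _).trans (f.norm_coe_le_norm x)

lemma exists_bump_integral_lt_of_null [TopologicalSpace.MetrizableSpace X] [BorelSpace X]
    {Z : Set X} (hZ : IsClosed Z) (μ : ProbabilityMeasure X)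
    (hμ : μ Z = 0) {δ : ℝ} (hδ : 0 < δ) :
    ∃ φ : C(X, ℝ), (∀ x, φ x ∈ Set.Icc (0 : ℝ) 1) ∧ (∀ x ∈ Z, φ x = 1) ∧
      ∫ x, φ x ∂(μ : Measure X) < δ := by
  rw [ProbabilityMeasure.null_iff_toMeasure_null] at hμ
  obtain ⟨W, hZW, hW, hμW⟩ := Z.exists_isOpen_lt_of_lt (μ := (μ : Measure X)) (ENNReal.ofReal δ)
    (by rw [hμ]; exact ENNReal.ofReal_pos.2 hδ)
  obtain ⟨φ, h0, h1, h01⟩ := exists_continuous_zero_one_of_isClosed hW.isClosed_compl hZ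
    (Set.disjoint_left.2 fun x hx hxZ => hx (hZW hxZ))
  refine ⟨φ, h01, h1, ?_⟩
  calc ∫ x, φ x ∂(μ : Measure X) ≤ ∫ x, W.indicator 1 x ∂(μ : Measure X) := by
        refine integral_mono (integrable_of_continuous μ φ.continuous)
          ((integrable_const (1 : ℝ)).indicator hW.measurableSet) fun x => ?_
        by_cases hx : x ∈ W
        · simpa [hx] using (h01 x).2
        · simpa [hx] using (h0 hx).le
    _ = (μ : Measure X).real W := integral_indicator_one hW.measurableSet
    _ < δ := (ENNReal.lt_ofReal_iff_toReal_lt (measure_ne_top _ _)).1 hμW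

/-- A closed set which is null for all measures in a compact set of measures has a bump function
with uniformly small integrals. -/
lemma exists_bump_forall_integral_lt [TopologicalSpace.MetrizableSpace X] [BorelSpace X]
    (hΔ : IsCompact Δ) {Z : Set X} (hZ : IsClosed Z)
    (hnull : ∀ μ ∈ Δ, μ Z = 0) {δ : ℝ} (hδ : 0 < δ) :
    ∃ φ : C(X, ℝ), (∀ x, φ x ∈ Set.Icc (0 : ℝ) 1) ∧ (∀ x ∈ Z, φ x = 1) ∧
      ∀ μ ∈ Δ, ∫ x, φ x ∂(μ : Measure X) < δ := by
  refine hΔ.induction_on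
    (p := fun S => ∃ φ : C(X, ℝ), (∀ x, φ x ∈ Set.Icc (0 : ℝ) 1) ∧ (∀ x ∈ Z, φ x = 1) ∧
      ∀ μ ∈ S, ∫ x, φ x ∂(μ : Measure X) < δ) ?_ ?_ ?_ ?_
  · exact ⟨1, by simp, by simp, by simp⟩
  · rintro S T hST ⟨φ, h01, h1, h⟩
    exact ⟨φ, h01, h1, fun μ hμ => h μ (hST hμ)⟩
  · rintro S T ⟨φ, h01, h1, h⟩ ⟨ψ, h01', h1', h'⟩
    refine ⟨φ ⊓ ψ, fun x => ⟨le_inf (h01 x).1 (h01' x).1, inf_le_left.trans (h01 x).2⟩,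
      fun x hx => by simp [h1 x hx, h1' x hx], ?_⟩
    rintro μ (hμ | hμ)
    · exact (integral_mono (integrable_of_continuous μ (φ ⊓ ψ).continuous)
        (integrable_of_continuous μ φ.continuous) fun x => inf_le_left).trans_lt (h μ hμ)
    · exact (integral_mono (integrable_of_continuous μ (φ ⊓ ψ).continuous)
        (integrable_of_continuous μ ψ.continuous) fun x => inf_le_right).trans_lt (h' μ hμ)
  · intro μ hμ
    obtain ⟨φ, h01, h1, h⟩ := exists_bump_integral_lt_of_null hZ μ (hnull μ hμ) hδ
    have hcont : Continuous fun ν : ProbabilityMeasure X => ∫ x, φ x ∂(ν : Measure X) :=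
      ProbabilityMeasure.continuous_integral_boundedContinuousFunction
        (BoundedContinuousFunction.mkOfCompact φ)
    exact ⟨_, mem_nhdsWithin_of_mem_nhds (hcont.continuousAt.eventually_lt_const h), φ, h01, h1,
      fun ν hν => hν⟩

/-- Under the small boundary property, a closed set inside an open set can be separated from the
complement by a set with null boundary. -/
lemma SmallBoundaryProperty.exists_between [TopologicalSpace.MetrizableSpace X]
    (h : SmallBoundaryProperty Δ) {K U : Set X}
    (hK : IsClosed K) (hU : IsOpen U) (hKU : K ⊆ U) :
    ∃ V : Set X, IsClosed V ∧ K ⊆ interior V ∧ V ⊆ U ∧ ∀ μ ∈ Δ, μ (frontier V) = 0 := by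
  refine hK.isCompact.induction_on
    (p := fun S => ∃ V : Set X, IsClosed V ∧ S ⊆ interior V ∧ V ⊆ U ∧
      ∀ μ ∈ Δ, μ (frontier V) = 0) ?_ ?_ ?_ ?_
  · exact ⟨∅, by simp⟩
  · rintro S T hST ⟨V, hV, hTV, h⟩
    exact ⟨V, hV, hST.trans hTV, h⟩
  · rintro S T ⟨V, hV, hSV, hVU, h⟩ ⟨W, hW, hTW, hWU, h'⟩
    refine ⟨V ∪ W, hV.union hW, ?_, Set.union_subset hVU hWU, fun μ hμ => ?_⟩
    · exact (Set.union_subset_union hSV hTW).trans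
        (Set.union_subset (interior_mono Set.subset_union_left)
          (interior_mono Set.subset_union_right))
    · have h1 := h μ hμ
      have h2 := h' μ hμ
      rw [ProbabilityMeasure.null_iff_toMeasure_null] at h1 h2 ⊢
      exact measure_mono_null ((frontier_union_subset V W).trans
        (Set.union_subset_union Set.inter_subset_left Set.inter_subset_right))
        (measure_union_null h1 h2)
  · intro x hx
    obtain ⟨V, hV, hxV, hVU, h⟩ := h x U hU (hKU hx)
    exact ⟨interior V, mem_nhdsWithin_of_mem_nhds (isOpen_interior.mem_nhds hxV), V, hV,
      subset_rfl, hVU, h⟩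

/-- Under the small boundary property, every continuous function `f` is close in the uniform
`2`-norm to a continuous function `g` with an almost inverse `h` whose norm depends only on the
closeness. -/
lemma SmallBoundaryProperty.exists_almost_invertible [TopologicalSpace.MetrizableSpace X]
    [BorelSpace X] (h : SmallBoundaryProperty Δ) (hΔ : IsCompact Δ)
    (f : C(X, ℝ)) {η δ : ℝ} (hη : 0 < η) (hδ : 0 < δ) :
    ∃ g h : C(X, ℝ), ‖g‖ ≤ ‖f‖ + η ∧ ‖h‖ ≤ η⁻¹ ∧
      (∀ μ ∈ Δ, ∫ x, (f x - g x) ^ 2 ∂(μ : Measure X) ≤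
        (2 * η) ^ 2 + (2 * ‖f‖ + η) ^ 2 * δ) ∧
      ∀ μ ∈ Δ, ∫ x, (g x * h x - 1) ^ 2 ∂(μ : Measure X) ≤ δ := by
  obtain ⟨V, hV, hKV, hVU, hnull⟩ := h.exists_between (K := {x | η ≤ f x}) (U := {x | -η < f x})
    (isClosed_le continuous_const f.continuous) (isOpen_lt continuous_const f.continuous)
    (fun x (hx : η ≤ f x) => show -η < f x by linarith)
  obtain ⟨φ, hφ01, hφ1, hφ⟩ := exists_bump_forall_integral_lt hΔ isClosed_frontier hnull
    (half_pos hδ)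
  have hφc : IsClosed {x | φ x ≤ 1 / 2} := isClosed_le φ.continuous continuous_const
  obtain ⟨s₀, hs0, hs1, hs01⟩ := exists_continuous_zero_one_of_isClosed
    (hV.inter hφc) ((isOpen_interior (s := V)).isClosed_compl.inter hφc) (by
      refine Set.disjoint_left.2 ?_
      rintro x ⟨hxV, hx⟩ ⟨hxV', _⟩
      have := hφ1 x (by rw [hV.frontier_eq]; exact ⟨hxV, hxV'⟩)
      have hx : φ x ≤ 1 / 2 := hx
      linarith)
  have hm (x : X) : 0 < max |f x| η := lt_max_of_lt_right hη
  have hfn (x : X) : |f x| ≤ ‖f‖ := f.norm_coe_le_norm x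
  let m : C(X, ℝ) := ⟨fun x => max |f x| η, by fun_prop⟩
  let r : C(X, ℝ) := ⟨fun x => (max |f x| η)⁻¹,
    Continuous.inv₀ (by fun_prop) fun x => (hm x).ne'⟩
  let s : C(X, ℝ) := ⟨fun x => 1 - 2 * s₀ x, by fun_prop⟩
  have hs (x : X) : |s x| ≤ 1 := by
    have := hs01 x
    simp only [s, ContinuousMap.coe_mk, abs_le]
    constructor <;> linarith [this.1, this.2]
  have hgx (x : X) : |(s * m) x| ≤ ‖f‖ + η := by
    simp only [m, ContinuousMap.mul_apply, ContinuousMap.coe_mk, abs_mul, abs_of_pos (hm x)]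
    calc |s x| * max |f x| η ≤ 1 * max |f x| η := by gcongr; exact hs x
      _ ≤ ‖f‖ + η := by
        rw [one_mul]
        exact max_le (by linarith [hfn x]) (by linarith [norm_nonneg f])
  have hgood (x : X) (hx : φ x ≤ 1 / 2) : |f x - (s * m) x| ≤ 2 * η ∧ s x ^ 2 = 1 := by
    simp only [m, ContinuousMap.mul_apply, ContinuousMap.coe_mk]
    by_cases hxV : x ∈ V
    · have hs' : s x = 1 := by simp [s, hs0 ⟨hxV, hx⟩]
      have hf : -η < f x := hVU hxV
      refine ⟨?_, by simp [hs']⟩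
      rw [hs', one_mul]
      rcases max_cases |f x| η with ⟨h1, h2⟩ | ⟨h1, h2⟩ <;> rcases abs_cases (f x) with h3 | h3 <;>
        rw [h1, abs_le] <;> constructor <;> linarith
    · have hs' : s x = -1 := by
        have : s₀ x = 1 := hs1 ⟨fun hx' => hxV (interior_subset hx'), hx⟩
        simp only [s, ContinuousMap.coe_mk, this]
        norm_num
      have hf : f x < η := not_le.1 fun hf => hxV (interior_subset (hKV hf))
      refine ⟨?_, by simp [hs']⟩
      rw [hs']
      rcases max_cases |f x| η with ⟨h1, h2⟩ | ⟨h1, h2⟩ <;> rcases abs_cases (f x) with h3 | h3 <;>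
        rw [h1, abs_le] <;> constructor <;> linarith
  have hgh (x : X) : (s * m) x * (s * r) x = s x ^ 2 := by
    simp only [m, r, ContinuousMap.mul_apply, ContinuousMap.coe_mk]
    have := (hm x).ne'
    field_simp
  refine ⟨s * m, s * r, ?_, ?_, fun μ hμ => ?_, fun μ hμ => ?_⟩
  · exact (ContinuousMap.norm_le _ (by positivity)).2 hgx
  · refine (ContinuousMap.norm_le _ (by positivity)).2 fun x => ?_
    simp only [r, ContinuousMap.mul_apply, ContinuousMap.coe_mk, Real.norm_eq_abs, abs_mul,
      abs_inv, abs_of_pos (hm x)]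
    calc |s x| * (max |f x| η)⁻¹ ≤ 1 * η⁻¹ := by
          gcongr
          exacts [hs x, le_max_right _ _]
      _ = η⁻¹ := one_mul _
  · calc ∫ x, (f x - (s * m) x) ^ 2 ∂(μ : Measure X)
        ≤ ∫ x, ((2 * η) ^ 2 + (2 * ‖f‖ + η) ^ 2 * 2 * φ x) ∂(μ : Measure X) := by
          refine integral_mono (integrable_of_continuous μ (by fun_prop))
            (integrable_of_continuous μ (by fun_prop)) fun x => ?_
          have h0 := (hφ01 x).1
          rcases le_or_gt (φ x) (1 / 2) with hx | hx
          · have := sq_le_sq.2 ((hgood x hx).1.trans (le_abs_self _))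
            have : 0 ≤ (2 * ‖f‖ + η) ^ 2 * 2 * φ x := by positivity
            dsimp only
            linarith
          · have h1 : |f x - (s * m) x| ≤ 2 * ‖f‖ + η :=
              (abs_sub _ _).trans (by linarith [hfn x, hgx x])
            have h2 := sq_le_sq.2 (h1.trans (le_abs_self _))
            have h3 : 0 ≤ (2 * ‖f‖ + η) ^ 2 * (2 * φ x - 1) :=
              mul_nonneg (sq_nonneg _) (by linarith)
            dsimp only
            nlinarith [sq_nonneg η]
      _ = (2 * η) ^ 2 + (2 * ‖f‖ + η) ^ 2 * 2 * ∫ x, φ x ∂(μ : Measure X) := by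
          rw [integral_add (integrable_const _) (integrable_of_continuous μ (by fun_prop)),
            integral_const_mul]
          simp
      _ ≤ (2 * η) ^ 2 + (2 * ‖f‖ + η) ^ 2 * 2 * (δ / 2) := by
          gcongr
          exact (hφ μ hμ).le
      _ = _ := by ring
  · calc ∫ x, ((s * m) x * (s * r) x - 1) ^ 2 ∂(μ : Measure X)
        ≤ ∫ x, 2 * φ x ∂(μ : Measure X) := by
          refine integral_mono (integrable_of_continuous μ (by fun_prop))
            (integrable_of_continuous μ (by fun_prop)) fun x => ?_
          have h0 := (hφ01 x).1
          dsimp only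
          rw [hgh]
          rcases le_or_gt (φ x) (1 / 2) with hx | hx
          · rw [(hgood x hx).2]
            linarith
          · have h1 : s x ^ 2 ≤ 1 := (sq_le_one_iff_abs_le_one _).2 (hs x)
            nlinarith [sq_nonneg (s x)]
      _ = 2 * ∫ x, φ x ∂(μ : Measure X) := integral_const_mul _ _
      _ ≤ δ := by linarith [hφ μ hμ]

/-- If every continuous function is close in the uniform `2`-norm to an almost invertible one, then
it is uniformly close to one that is bounded away from zero off a set of small measure. -/
lemma exists_dist_le_measureReal_lt [BorelSpace X]
    (H : ∀ (f : C(X, ℝ)) (ε : ℝ), 0 < ε → ∃ g h : C(X, ℝ), ∀ μ ∈ Δ,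
      ∫ x, (f x - g x) ^ 2 ∂(μ : Measure X) < ε ∧ ∫ x, (g x * h x - 1) ^ 2 ∂(μ : Measure X) < ε)
    (f : C(X, ℝ)) {η κ : ℝ} (hη : 0 < η) (hκ : 0 < κ) :
    ∃ g : C(X, ℝ), dist g f ≤ η ∧ ∃ c > 0, ∀ μ ∈ Δ, (μ : Measure X).real {x | |g x| < c} < κ := by
  obtain ⟨g, h, hgh⟩ := H f (min (η ^ 2 * κ / 2) (κ / 8)) (by positivity)
  let k : C(X, ℝ) := ⟨fun x => f x + max (-η) (min η (g x - f x)), by fun_prop⟩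
  have hc : 0 < (2 * (‖h‖ + 1))⁻¹ := by positivity
  refine ⟨k, ?_, (2 * (‖h‖ + 1))⁻¹, hc, fun μ hμ => ?_⟩
  · refine (ContinuousMap.dist_le hη.le).2 fun x => ?_
    simp only [k, ContinuousMap.coe_mk, Real.dist_eq, add_sub_cancel_left]
    exact abs_le.2 ⟨le_max_left _ _, max_le (by linarith) (min_le_left _ _)⟩
  have hmeas : MeasurableSet {x | |k x| < (2 * (‖h‖ + 1))⁻¹} :=
    (isOpen_lt (by fun_prop) continuous_const).measurableSet
  obtain ⟨h1, h2⟩ := hgh μ hμ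
  have h1 := h1.trans_le (min_le_left _ _)
  have h2 := h2.trans_le (min_le_right _ _)
  rw [← integral_indicator_one hmeas]
  calc ∫ x, {x | |k x| < (2 * (‖h‖ + 1))⁻¹}.indicator 1 x ∂(μ : Measure X)
      ≤ ∫ x, ((η ^ 2)⁻¹ * (f x - g x) ^ 2 + 4 * (g x * h x - 1) ^ 2) ∂(μ : Measure X) := by
        refine integral_mono ((integrable_const (1 : ℝ)).indicator hmeas)
          (integrable_of_continuous μ (by fun_prop)) fun x => ?_
        refine Set.indicator_apply_le' (fun hx => ?_) (fun _ => by positivity)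
        have hx : |k x| < (2 * (‖h‖ + 1))⁻¹ := hx
        rw [Pi.one_apply]
        rcases le_or_gt η |f x - g x| with hfg | hfg
        · have h3 : 1 ≤ (η ^ 2)⁻¹ * (f x - g x) ^ 2 := by
            rw [← div_eq_inv_mul, one_le_div (by positivity), ← sq_abs (f x - g x)]
            gcongr
          have h4 : 0 ≤ 4 * (g x * h x - 1) ^ 2 := by positivity
          linarith
        · have hkg : k x = g x := by
            rw [abs_lt] at hfg
            simp only [k, ContinuousMap.coe_mk]
            rw [min_eq_right (by linarith), max_eq_right (by linarith)]
            ring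
          rw [hkg] at hx
          have h3 : |g x * h x| ≤ 1 / 2 := by
            rw [abs_mul]
            calc |g x| * |h x| ≤ (2 * (‖h‖ + 1))⁻¹ * (‖h‖ + 1) := by
                  gcongr
                  exact (h.norm_coe_le_norm x).trans (by linarith)
              _ = 1 / 2 := by
                  have : ‖h‖ + 1 ≠ 0 := by positivity
                  field_simp
          have h4 : 0 ≤ (η ^ 2)⁻¹ * (f x - g x) ^ 2 := by positivity
          have h5 := (abs_le.1 h3).2
          nlinarith
    _ = (η ^ 2)⁻¹ * ∫ x, (f x - g x) ^ 2 ∂(μ : Measure X) +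
          4 * ∫ x, (g x * h x - 1) ^ 2 ∂(μ : Measure X) := by
        rw [integral_add (integrable_of_continuous μ (by fun_prop))
          (integrable_of_continuous μ (by fun_prop)), integral_const_mul, integral_const_mul]
    _ < (η ^ 2)⁻¹ * (η ^ 2 * κ / 2) + 4 * (κ / 8) := by gcongr
    _ = κ := by
        field_simp
        ring

/-- If every continuous function is close in the uniform `2`-norm to an almost invertible one, then
the continuous functions with null zero set are uniformly dense. -/
lemma exists_dist_lt_zero_set_null [BorelSpace X]
    (H : ∀ (f : C(X, ℝ)) (ε : ℝ), 0 < ε → ∃ g h : C(X, ℝ), ∀ μ ∈ Δ,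
      ∫ x, (f x - g x) ^ 2 ∂(μ : Measure X) < ε ∧ ∫ x, (g x * h x - 1) ^ 2 ∂(μ : Measure X) < ε)
    (f : C(X, ℝ)) {η : ℝ} (hη : 0 < η) :
    ∃ g : C(X, ℝ), dist g f < η ∧ ∀ μ ∈ Δ, (μ : Measure X) {x | g x = 0} = 0 := by
  let O (n : ℕ) : Set C(X, ℝ) :=
    {g | ∃ c > 0, ∀ μ ∈ Δ, (μ : Measure X).real {x | |g x| < c} < 1 / ((n : ℝ) + 1)}
  have hopen (n : ℕ) : IsOpen (O n) := by
    refine Metric.isOpen_iff.2 fun g ⟨c, hc, hg⟩ => ⟨c / 2, half_pos hc, fun k hk => ?_⟩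
    refine ⟨c / 2, half_pos hc, fun μ hμ => (measureReal_mono fun x hx => ?_).trans_lt (hg μ hμ)⟩
    have hx : |k x| < c / 2 := hx
    have hkx : |k x - g x| < c / 2 := (ContinuousMap.dist_apply_le_dist x).trans_lt hk
    show |g x| < c
    rw [abs_lt] at hx hkx ⊢
    constructor <;> linarith
  have hdense (n : ℕ) : Dense (O n) := by
    refine Metric.dense_iff.2 fun k r hr => ?_
    obtain ⟨g, hg, hc⟩ := exists_dist_le_measureReal_lt H k (half_pos hr)
      (Nat.one_div_pos_of_nat (α := ℝ) (n := n))
    exact ⟨g, hg.trans_lt (half_lt_self hr), hc⟩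
  obtain ⟨g, hgf, hg⟩ := Metric.dense_iff.1 (dense_iInter_of_isOpen_nat hopen hdense) f η hη
  refine ⟨g, hgf, fun μ hμ => ?_⟩
  rw [← measureReal_eq_zero_iff]
  refine le_antisymm (le_of_forall_pos_lt_add fun ε hε => ?_) measureReal_nonneg
  obtain ⟨n, hn⟩ := exists_nat_one_div_lt hε
  obtain ⟨c, hc, hgc⟩ := Set.mem_iInter.1 hg n
  rw [zero_add]
  refine ((measureReal_mono fun x hx => ?_).trans_lt (hgc μ hμ)).trans hn
  have hx : g x = 0 := hx
  simpa [hx] using hc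

lemma SmallBoundaryProperty.of_almost_invertible [TopologicalSpace.MetrizableSpace X]
    [BorelSpace X]
    (H : ∀ (f : C(X, ℝ)) (ε : ℝ), 0 < ε → ∃ g h : C(X, ℝ), ∀ μ ∈ Δ,
      ∫ x, (f x - g x) ^ 2 ∂(μ : Measure X) < ε ∧
        ∫ x, (g x * h x - 1) ^ 2 ∂(μ : Measure X) < ε) :
    SmallBoundaryProperty Δ := by
  intro x U hU hxU
  obtain ⟨f, hf0, hf1, -⟩ := exists_continuous_zero_one_of_isClosed hU.isClosed_compl
    (isClosed_singleton (x := x)) (by simpa using hxU)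
  obtain ⟨g, hgf, hg⟩ := exists_dist_lt_zero_set_null H (f - .const X (1 / 2))
    (η := 1 / 2) (by norm_num)
  have hgx (y : X) : |g y - (f y - 1 / 2)| < 1 / 2 :=
    (ContinuousMap.dist_apply_le_dist y).trans_lt hgf
  refine ⟨{y | 0 ≤ g y}, isClosed_le continuous_const g.continuous, ?_, fun y hy => ?_,
    fun μ hμ => ?_⟩
  · refine interior_maximal (fun y (hy : 0 < g y) => hy.le)
      (isOpen_lt continuous_const g.continuous) ?_
    have h1 := hf1 (Set.mem_singleton x)
    have h2 := (abs_lt.1 (hgx x)).1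
    rw [h1, Pi.one_apply] at h2
    show 0 < g x
    linarith
  · by_contra hyU
    have h1 := hf0 hyU
    have h2 := (abs_lt.1 (hgx y)).2
    rw [h1, Pi.zero_apply] at h2
    have hy : 0 ≤ g y := hy
    linarith
  · rw [ProbabilityMeasure.null_iff_toMeasure_null]
    refine measure_mono_null ((frontier_le_subset_eq continuous_const g.continuous).trans ?_)
      (hg μ hμ)
    exact fun y hy => Eq.symm hy

end SmallBoundary

theorem sbp_iff_weak_real_rank_zero
    {X : Type*} [TopologicalSpace X] [CompactSpace X] [TopologicalSpace.MetrizableSpace X]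
    [MeasurableSpace X] [BorelSpace X]
    (Δ : Set (ProbabilityMeasure X)) (hΔ : IsClosed Δ)
    (ω : Ultrafilter ℕ) (hω : (ω : Filter ℕ) ≤ Filter.cofinite) :
    SmallBoundaryProperty Δ ↔
      ∀ f : ℕ → C(X, ℝ), (∃ M : ℝ, ∀ n, ‖f n‖ ≤ M) →
        ∀ ε : ℝ, 0 < ε →
          ∃ g h : ℕ → C(X, ℝ),
            (∃ M : ℝ, ∀ n, ‖g n‖ ≤ M) ∧ (∃ M : ℝ, ∀ n, ‖h n‖ ≤ M) ∧
            (∃ L : ℝ, L < ε ∧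
              Tendsto
                (fun n => ⨆ μ ∈ Δ,
                  Real.sqrt (∫ x, (f n x - g n x) ^ 2 ∂(μ : Measure X)))
                (ω : Filter ℕ) (nhds L)) ∧
            Tendsto
              (fun n => ⨆ μ ∈ Δ, ∫ x, (g n x * h n x - 1) ^ 2 ∂(μ : Measure X))
              (ω : Filter ℕ) (nhds 0) := by
  constructor
  · rintro hS f ⟨M, hM⟩ ε hε
    have hM0 : 0 ≤ M := (norm_nonneg _).trans (hM 0)
    set η := ε / 8 with hηdef
    have hη : 0 < η := by positivity
    let δ (n : ℕ) : ℝ := min (1 / ((n : ℝ) + 1)) (ε ^ 2 / 16 / (2 * M + η) ^ 2)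
    have hδ (n : ℕ) : 0 < δ n := lt_min Nat.one_div_pos_of_nat (by positivity)
    choose g h hg hh hfg hgh using fun n =>
      hS.exists_almost_invertible hΔ.isCompact (f n) hη (hδ n)
    have hmem (n : ℕ) : (⨆ μ ∈ Δ, Real.sqrt (∫ x, (f n x - g n x) ^ 2 ∂(μ : Measure X))) ∈
        Set.Icc 0 (ε / 2) := by
      refine ⟨biSup_nonneg_of_nonneg fun μ => Real.sqrt_nonneg _,
        biSup_le_of_nonneg (by positivity) fun μ hμ => Real.sqrt_le_iff.2 ⟨by positivity, ?_⟩⟩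
      calc ∫ x, (f n x - g n x) ^ 2 ∂(μ : Measure X)
          ≤ (2 * η) ^ 2 + (2 * ‖f n‖ + η) ^ 2 * δ n := hfg n μ hμ
        _ ≤ (2 * η) ^ 2 + (2 * M + η) ^ 2 * (ε ^ 2 / 16 / (2 * M + η) ^ 2) := by
          gcongr
          exacts [hM n, min_le_right _ _]
        _ = (2 * η) ^ 2 + ε ^ 2 / 16 := by
          rw [mul_div_cancel₀ _ (by positivity)]
        _ ≤ (ε / 2) ^ 2 := by
          rw [hηdef]
          nlinarith [sq_nonneg ε]
    refine ⟨g, h, ⟨M + η, fun n => (hg n).trans (by linarith [hM n])⟩, ⟨η⁻¹, hh⟩, ?_, ?_⟩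
    · obtain ⟨L, hL, hlim⟩ := isCompact_Icc.ultrafilter_le_nhds (ω.map _)
        (le_principal_iff.2 (Filter.mem_map.2 (univ_mem' hmem)))
      exact ⟨L, by linarith [hL.2], hlim⟩
    · rw [Nat.cofinite_eq_atTop] at hω
      refine squeeze_zero (fun n => biSup_nonneg_of_nonneg fun μ =>
        integral_nonneg fun x => sq_nonneg _) (fun n => ?_)
        ((tendsto_one_div_add_atTop_nhds_zero_nat (𝕜 := ℝ)).mono_left hω)
      exact biSup_le_of_nonneg Nat.one_div_pos_of_nat.le fun μ hμ =>
        (hgh n μ hμ).trans (min_le_left _ _)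
  · intro H
    refine SmallBoundaryProperty.of_almost_invertible fun f ε hε => ?_
    obtain ⟨g, h, -, -, ⟨L, hL, hfg⟩, hgh⟩ := H (fun _ => f) ⟨‖f‖, fun _ => le_rfl⟩ (Real.sqrt ε)
      (Real.sqrt_pos.2 hε)
    obtain ⟨n, hn1, hn2⟩ :=
      ((hfg.eventually_lt_const hL).and (hgh.eventually_lt_const hε)).exists
    refine ⟨g n, h n, fun μ hμ => ⟨?_, ?_⟩⟩
    · refine (Real.sqrt_lt_sqrt_iff (integral_nonneg fun x => sq_nonneg _)).1
        (lt_of_le_of_lt ?_ hn1)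
      exact le_biSup_of_bounded
        (F := fun μ : ProbabilityMeasure X =>
          Real.sqrt (∫ x, (f x - g n x) ^ 2 ∂(μ : Measure X)))
        (Real.sqrt_nonneg ‖(f - g n) ^ 2‖)
        (fun ν _ => Real.sqrt_le_sqrt (integral_le_norm ν ((f - g n) ^ 2))) hμ
    · refine lt_of_le_of_lt ?_ hn2
      exact le_biSup_of_bounded
        (F := fun μ : ProbabilityMeasure X => ∫ x, (g n x * h n x - 1) ^ 2 ∂(μ : Measure X))
        (norm_nonneg ((g n * h n - 1) ^ 2))
        (fun ν _ => integral_le_norm ν ((g n * h n - 1) ^ 2)) hμ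
end
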